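/- Let f̌ : ℕ → ℍ be a coefficient sequence such that the power series f(q) = ∑_{n≥0} qⁿ f̌(n) converges for every q ∈ 𝔹. Then f belongs to H¹(𝔹) if and only if f belongs to the weak ⋆-product space H²(𝔹) ⊛ H²(𝔹), i.e. if and only if there exist sequences of coefficient sequences f̌_j, ǧ_j : ℕ → ℍ (j ≥ 1), each with finite H²-norm ‖f_j‖ = (∑_n |f̌_j(n)|²)^{1/2} and ‖g_j‖ = (∑_n |ǧ_j(n)|²)^{1/2}, such that ∑_{j≥1} ‖f_j‖·‖g_j‖ < ∞ and for every n ≥ 0, f̌(n) = ∑_{j≥1} ∑_{k=0}^{n} f̌_j(k)·ǧ_j(n−k) (the sum over j converging absolutely). -/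

import Mathlib

open scoped Quaternion ENNReal
open MeasureTheory

/-- `e^{Iθ} = cos θ + I sin θ` for an imaginary unit `I`. -/
noncomputable def expQ (I : ℍ[ℝ]) (θ : ℝ) : ℍ[ℝ] := Real.cos θ • (1 : ℍ[ℝ]) + Real.sin θ • I

/-- Membership in the quaternionic Hardy space `H¹(𝔹)` for a regular function given by
its coefficient sequence `f̌`. -/
def MemH1 (f : ℕ → ℍ[ℝ]) : Prop :=
  ∃ M : ℝ, ∀ I : ℍ[ℝ], I.re = 0 → ‖I‖ = 1 → ∀ r : ℝ, 0 < r → r < 1 →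
    (1 / (2 * Real.pi)) *
        ∫ θ in (-Real.pi)..Real.pi, ‖∑' n : ℕ, (r • expQ I θ) ^ n * f n‖ ≤ M

/-- The average of a function of the angle over a full period. -/
noncomputable def circAvg (g : ℝ → ℝ) : ℝ := 1 / (2 * Real.pi) * ∫ θ in (-Real.pi)..Real.pi, g θ

lemma circAvg_mono {g h : ℝ → ℝ} (hg : Continuous g) (hh : Continuous h) (H : ∀ θ, g θ ≤ h θ) :
    circAvg g ≤ circAvg h :=
  mul_le_mul_of_nonneg_left
    (intervalIntegral.integral_mono_on (by linarith [Real.pi_pos]) (hg.intervalIntegrable _ _)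
      (hh.intervalIntegrable _ _) fun θ _ => H θ) (by positivity)

lemma circAvg_add {g h : ℝ → ℝ} (hg : Continuous g) (hh : Continuous h) :
    circAvg (fun θ => g θ + h θ) = circAvg g + circAvg h := by
  unfold circAvg
  rw [intervalIntegral.integral_add (hg.intervalIntegrable _ _) (hh.intervalIntegrable _ _), mul_add]

lemma circAvg_const (c : ℝ) : circAvg (fun _ => c) = c := by
  have := Real.pi_pos
  simp only [circAvg, intervalIntegral.integral_const, smul_eq_mul]
  field_simp
  ring

lemma circAvg_nonneg {g : ℝ → ℝ} (hg : Continuous g) (H : ∀ θ, 0 ≤ g θ) : 0 ≤ circAvg g :=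
  (circAvg_const 0).symm.le.trans (circAvg_mono continuous_const hg H)

lemma integral_cexp_natCast_sub (m n : ℕ) :
    ∫ θ in (-Real.pi)..Real.pi, Complex.exp (((m : ℂ) - n) * Complex.I * (θ : ℂ)) =
      if m = n then 2 * (Real.pi : ℂ) else 0 := by
  split_ifs with h
  · subst h
    simp
    ring
  · have hc : ((m : ℂ) - n) * Complex.I ≠ 0 :=
      mul_ne_zero (sub_ne_zero.2 (by exact_mod_cast h)) Complex.I_ne_zero
    rw [integral_exp_mul_complex hc, div_eq_zero_iff, sub_eq_zero]
    left
    rw [Complex.exp_eq_exp_iff_exists_int]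
    exact ⟨(m : ℤ) - n, by push_cast; ring⟩

/-- Parseval's identity for an absolutely convergent power series on the unit circle. -/
lemma circAvg_norm_sq_tsum {b : ℕ → ℂ} (hb : Summable fun n => ‖b n‖) :
    circAvg (fun θ => ‖∑' n, b n * Complex.exp (θ * Complex.I) ^ n‖ ^ 2) = ∑' n, ‖b n‖ ^ 2 := by
  set c : ℕ × ℕ → ℝ → ℂ := fun p θ =>
    b p.1 * star (b p.2) * Complex.exp (((p.1 : ℂ) - p.2) * Complex.I * (θ : ℂ)) with hc
  have hE : ∀ θ : ℝ, ‖Complex.exp (θ * Complex.I)‖ = 1 := Complex.norm_exp_ofReal_mul_I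
  have hcont : ∀ p, Continuous (c p) := fun p => by fun_prop
  have hnorm : ∀ p θ, ‖c p θ‖ = ‖b p.1‖ * ‖b p.2‖ := fun p θ => by
    have : ((p.1 : ℂ) - p.2) * Complex.I * (θ : ℂ) = (((p.1 : ℝ) - p.2) * θ : ℝ) * Complex.I := by
      push_cast; ring
    rw [hc]
    simp only [this, norm_mul, Complex.norm_exp_ofReal_mul_I, norm_star, mul_one]
  have hsum2 : Summable fun p : ℕ × ℕ => ‖b p.1‖ * ‖b p.2‖ := by
    have h' : Summable fun n => ‖‖b n‖‖ := by simpa using hb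
    exact summable_mul_of_summable_norm h' h'
  have key : ∀ θ : ℝ, ∑' p, c p θ =
      ((‖∑' n, b n * Complex.exp (θ * Complex.I) ^ n‖ ^ 2 : ℝ) : ℂ) := fun θ => by
    have h1 : Summable fun n => ‖b n * Complex.exp (θ * Complex.I) ^ n‖ := by simpa [hE] using hb
    have h2 : Summable fun n => ‖star (b n * Complex.exp (θ * Complex.I) ^ n)‖ := by
      simpa only [norm_star] using h1
    rw [Complex.ofReal_pow, ← Complex.mul_conj', ← Complex.star_def, tsum_star,
      tsum_mul_tsum_of_summable_norm h1 h2]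
    refine tsum_congr fun p => ?_
    simp only [hc, star_mul, star_pow, Complex.star_def]
    rw [← Complex.exp_conj, ← Complex.exp_nat_mul, ← Complex.exp_nat_mul]
    have : Complex.exp (((p.1 : ℂ) - p.2) * Complex.I * (θ : ℂ)) =
        Complex.exp (p.1 * (θ * Complex.I)) *
          Complex.exp (p.2 * (starRingEnd ℂ) (θ * Complex.I)) := by
      rw [← Complex.exp_add]
      congr 1
      simp
      ring
    rw [this]
    ring
  have hint := intervalIntegral.tsum_intervalIntegral_eq_of_summable_norm
    (a := -Real.pi) (b := Real.pi) (f := fun p => ⟨c p, hcont p⟩) (by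
      refine Summable.of_nonneg_of_le (fun p => norm_nonneg _) (fun p => ?_) hsum2
      rw [ContinuousMap.norm_le _ (by positivity)]
      intro x
      simpa using (hnorm p x).le)
  simp only [ContinuousMap.coe_mk, key] at hint
  have hdiag : ∀ p : ℕ × ℕ, ∫ θ in (-Real.pi)..Real.pi, c p θ =
      if p.1 = p.2 then 2 * (Real.pi : ℂ) * ((‖b p.1‖ ^ 2 : ℝ) : ℂ) else 0 := fun p => by
    simp only [hc]
    rw [intervalIntegral.integral_const_mul, integral_cexp_natCast_sub]
    split_ifs with h
    · rw [← h, Complex.star_def, Complex.mul_conj']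
      push_cast
      ring
    · simp
  simp only [hdiag] at hint
  have hinj : Function.Injective fun n : ℕ => (n, n) := fun a b h => (Prod.ext_iff.1 h).1
  rw [← hinj.tsum_eq (by
    intro p hp
    by_contra hne
    refine hp (if_neg fun h => hne ⟨p.1, Prod.ext rfl h⟩))] at hint
  simp only [if_true] at hint
  rw [tsum_mul_left, ← Complex.ofReal_tsum, intervalIntegral.integral_ofReal] at hint
  have h3 : 2 * Real.pi * ∑' n, ‖b n‖ ^ 2 = ∫ θ in (-Real.pi)..Real.pi,
      ‖∑' n, b n * Complex.exp (θ * Complex.I) ^ n‖ ^ 2 := by exact_mod_cast hint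
  rw [circAvg, ← h3]
  have := Real.pi_pos
  field_simp

lemma sum_mul_pow_mul_pow (F G : ℕ → ℂ) (z : ℂ) (n : ℕ) :
    ∑ k ∈ Finset.range (n + 1), F k * z ^ k * (G (n - k) * z ^ (n - k)) =
      (∑ k ∈ Finset.range (n + 1), F k * G (n - k)) * z ^ n := by
  rw [Finset.sum_mul]
  refine Finset.sum_congr rfl fun k hk => ?_
  rw [← Nat.add_sub_of_le (Nat.lt_succ_iff.1 (Finset.mem_range.1 hk)), pow_add]
  simp only [Nat.add_sub_cancel_left]
  ring

lemma circAvg_const_mul (c : ℝ) (g : ℝ → ℝ) : circAvg (fun θ => c * g θ) = c * circAvg g := by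
  unfold circAvg
  rw [intervalIntegral.integral_const_mul]
  ring

/-- Cauchy–Schwarz inequality for averages over a period. -/
lemma circAvg_mul_sq_le {g h : ℝ → ℝ} (hg : Continuous g) (hh : Continuous h) :
    circAvg (fun θ => g θ * h θ) ^ 2 ≤ circAvg (fun θ => g θ ^ 2) * circAvg (fun θ => h θ ^ 2) := by
  have key : ∀ t : ℝ, 0 ≤ circAvg (fun θ => g θ ^ 2) * (t * t) +
      (2 * circAvg (fun θ => g θ * h θ)) * t + circAvg (fun θ => h θ ^ 2) := fun t => by
    have h0 : 0 ≤ circAvg (fun θ => (t * t) * g θ ^ 2 + (2 * t) * (g θ * h θ) + h θ ^ 2) :=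
      circAvg_nonneg (by fun_prop) fun θ => by nlinarith [sq_nonneg (t * g θ + h θ)]
    rw [circAvg_add (by fun_prop) (by fun_prop), circAvg_add (by fun_prop) (by fun_prop),
      circAvg_const_mul, circAvg_const_mul] at h0
    linarith
  have := discrim_le_zero key
  unfold discrim at this
  nlinarith

lemma Summable.norm_sq_of_norm {b : ℕ → ℂ} (hb : Summable fun n => ‖b n‖) :
    Summable fun n => ‖b n‖ ^ 2 := by
  have h' : Summable fun n => ‖‖b n‖‖ := by simpa using hb
  have := (summable_mul_of_summable_norm h' h').comp_injective
    (i := fun n : ℕ => (n, n)) fun a b h => (Prod.ext_iff.1 h).1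
  exact this.congr fun n => (sq _).symm

lemma eq_of_tsum_circle_eq {a b : ℕ → ℂ} {r : ℝ} (hr : 0 < r)
    (ha : Summable fun n => ‖a n‖ * r ^ n) (hb : Summable fun n => ‖b n‖ * r ^ n)
    (h : ∀ θ : ℝ, ∑' n, a n * (r * Complex.exp (θ * Complex.I)) ^ n =
      ∑' n, b n * (r * Complex.exp (θ * Complex.I)) ^ n) (n : ℕ) : a n = b n := by
  have hE : ∀ θ : ℝ, ‖Complex.exp (θ * Complex.I)‖ = 1 := Complex.norm_exp_ofReal_mul_I
  have hd : Summable fun n => ‖(a n - b n) * (r : ℂ) ^ n‖ := by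
    refine Summable.of_nonneg_of_le (fun n => norm_nonneg _) (fun n => ?_) (ha.add hb)
    rw [norm_mul, norm_pow, Complex.norm_real, Real.norm_of_nonneg hr.le, ← add_mul]
    gcongr
    exact norm_sub_le _ _
  have hs := circAvg_norm_sq_tsum hd
  have hz : ∀ θ : ℝ, ∑' n, (a n - b n) * (r : ℂ) ^ n * Complex.exp (θ * Complex.I) ^ n = 0 := by
    intro θ
    have h1 : ∀ c : ℕ → ℂ, (Summable fun n => ‖c n‖ * r ^ n) →
        Summable fun n => c n * (r * Complex.exp (θ * Complex.I)) ^ n := fun c hc => by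
      refine Summable.of_norm ?_
      simpa [hE, abs_of_pos hr] using hc
    rw [← sub_eq_zero.2 (h θ), ← (h1 a ha).tsum_sub (h1 b hb)]
    exact tsum_congr fun n => by rw [mul_pow]; ring
  simp only [hz, norm_zero, ne_eq, OfNat.ofNat_ne_zero, not_false_eq_true, zero_pow,
    circAvg_const] at hs
  have h0 := (hd.norm_sq_of_norm.hasSum_iff.2 hs.symm)
  rw [hasSum_zero_iff_of_nonneg fun n => by positivity] at h0
  have := congrFun h0 n
  simpa [sub_eq_zero, hr.ne'] using this

lemma one_sub_mul_re_pos {w z : ℂ} (hw : ‖w‖ ≤ 1) (hz : ‖z‖ < 1) : 0 < (1 - w * z).re := by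
  have h1 : ‖w * z‖ < 1 := by
    rw [norm_mul]
    nlinarith [norm_nonneg w, norm_nonneg z]
  have := (Complex.re_le_norm (w * z)).trans_lt h1
  simp only [Complex.sub_re, Complex.one_re]
  linarith

lemma exists_holomorphic_sqrt_one_sub_mul {w : ℂ} (hw : ‖w‖ ≤ 1) :
    ∃ s : ℂ → ℂ, DifferentiableOn ℂ s (Metric.ball 0 1) ∧
      ∀ z, s z * s z = 1 - w * z := by
  refine ⟨fun z => (1 - w * z) ^ ((2 : ℕ) : ℂ)⁻¹, fun z hz => ?_, fun z => ?_⟩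
  · refine DifferentiableAt.differentiableWithinAt ?_
    refine DifferentiableAt.cpow_const (by fun_prop)
      (Or.inl (one_sub_mul_re_pos hw (by simpa using hz)))
  · rw [← sq]
    exact Complex.cpow_nat_inv_pow _ two_ne_zero

lemma norm_sub_sq_add (a z : ℂ) :
    ‖z - a‖ ^ 2 + (1 - ‖a‖ ^ 2) * (1 - ‖z‖ ^ 2) = ‖1 - star a * z‖ ^ 2 := by
  simp only [Complex.sq_norm, Complex.normSq_apply, Complex.sub_re, Complex.sub_im, Complex.mul_re,
    Complex.mul_im, Complex.star_def, Complex.conj_re, Complex.conj_im, Complex.one_re,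
    Complex.one_im]
  ring

/-- A split polynomial factors on the disc as a product of two holomorphic functions whose squared
moduli are dominated by a continuous function having the modulus of the polynomial on the circle. -/
lemma exists_holomorphic_factorization (c : ℂ) (s : Multiset ℂ) :
    ∃ u v q : ℂ → ℂ, DifferentiableOn ℂ u (Metric.ball 0 1) ∧
      DifferentiableOn ℂ v (Metric.ball 0 1) ∧ Continuous q ∧
      (∀ z, ‖z‖ < 1 → u z * v z = c * (s.map fun a => z - a).prod) ∧
      (∀ z, ‖z‖ < 1 → ‖u z‖ ^ 2 ≤ ‖q z‖) ∧ (∀ z, ‖z‖ < 1 → ‖v z‖ ^ 2 ≤ ‖q z‖) ∧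
      ∀ z, ‖z‖ = 1 → ‖q z‖ = ‖c * (s.map fun a => z - a).prod‖ := by
  induction s using Multiset.induction with
  | empty =>
    obtain ⟨d, hd⟩ := IsAlgClosed.exists_pow_nat_eq c two_pos
    refine ⟨fun _ => d, fun _ => d, fun _ => c, by fun_prop, by fun_prop, by fun_prop, ?_, ?_, ?_,
      ?_⟩ <;> intros <;> simp [← hd, sq]
  | cons a s ih =>
    obtain ⟨u, v, q, hu, hv, hq, huv, huq, hvq, hqc⟩ := ih
    rcases le_or_gt 1 ‖a‖ with ha | ha
    · have ha0 : a ≠ 0 := norm_pos_iff.1 (by linarith)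
      obtain ⟨d, hd⟩ := IsAlgClosed.exists_pow_nat_eq (-a) two_pos
      obtain ⟨t, ht, ht2⟩ := exists_holomorphic_sqrt_one_sub_mul (w := a⁻¹)
        (by rw [norm_inv]; exact inv_le_one_of_one_le₀ ha)
      have hsq : ∀ z, (d * t z) * (d * t z) = z - a := fun z => by
        rw [mul_mul_mul_comm, ht2, ← sq, hd]
        field_simp
        ring
      have hsn : ∀ z, ‖d * t z‖ ^ 2 = ‖z - a‖ := fun z => by rw [← hsq, norm_mul _ (d * t z), sq]
      refine ⟨fun z => u z * (d * t z), fun z => v z * (d * t z), fun z => q z * (z - a),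
        hu.mul (ht.const_mul d), hv.mul (ht.const_mul d), by fun_prop, fun z hz => ?_,
        fun z hz => ?_, fun z hz => ?_, fun z hz => ?_⟩
      · rw [mul_mul_mul_comm, hsq, huv z hz, Multiset.map_cons, Multiset.prod_cons]
        ring
      · rw [norm_mul, mul_pow, hsn, norm_mul]
        gcongr
        exact huq z hz
      · rw [norm_mul, mul_pow, hsn, norm_mul]
        gcongr
        exact hvq z hz
      · rw [norm_mul, hqc z hz, Multiset.map_cons, Multiset.prod_cons]
        simp only [norm_mul]
        ring
    · obtain ⟨t, ht, ht2⟩ := exists_holomorphic_sqrt_one_sub_mul (w := star a)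
        (by rw [norm_star]; exact ha.le)
      have htn : ∀ z, ‖t z‖ ^ 2 = ‖1 - star a * z‖ := fun z => by rw [← ht2, norm_mul, sq]
      have ht0 : ∀ z, ‖z‖ < 1 → t z ≠ 0 := fun z hz h0 => by
        have h1 := one_sub_mul_re_pos (w := star a) (by rw [norm_star]; exact ha.le) hz
        rw [← ht2, h0] at h1
        simp at h1
      refine ⟨fun z => u z * t z, fun z => v z * ((z - a) / t z), fun z => q z * (1 - star a * z),
        hu.mul ht, hv.mul (DifferentiableOn.div (by fun_prop) ht fun z hz => ht0 z (by simpa using hz)),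
        by fun_prop, fun z hz => ?_, fun z hz => ?_, fun z hz => ?_, fun z hz => ?_⟩
      · have := ht0 z hz
        rw [Multiset.map_cons, Multiset.prod_cons, mul_left_comm c, ← huv z hz]
        field_simp
      · rw [norm_mul, mul_pow, htn, norm_mul]
        gcongr
        exact huq z hz
      · rw [norm_mul, mul_pow, norm_mul, norm_div, div_pow, htn]
        gcongr
        · exact hvq z hz
        · refine div_le_of_le_mul₀ (norm_nonneg _) (norm_nonneg _) ?_
          rw [← sq, ← norm_sub_sq_add]
          have h1 : ‖a‖ ^ 2 ≤ 1 := by nlinarith [norm_nonneg a]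
          have h2 : ‖z‖ ^ 2 ≤ 1 := by nlinarith [norm_nonneg z]
          nlinarith
      · have h1 : ‖1 - star a * z‖ = ‖z - a‖ := by
          rw [← sq_eq_sq₀ (norm_nonneg _) (norm_nonneg _), ← norm_sub_sq_add, hz]
          ring
        rw [norm_mul, hqc z hz, h1, Multiset.map_cons, Multiset.prod_cons]
        simp only [norm_mul]
        ring

/-- Taylor coefficients of a holomorphic function on the disc, with Bessel's inequality. -/
lemma exists_coeff_of_norm_sq_le {u q : ℂ → ℂ} (hu : DifferentiableOn ℂ u (Metric.ball 0 1))
    (hq : Continuous q) (huq : ∀ z, ‖z‖ < 1 → ‖u z‖ ^ 2 ≤ ‖q z‖) :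
    ∃ c : ℕ → ℂ, (∀ z, ‖z‖ < 1 → HasSum (fun n => c n * z ^ n) (u z)) ∧
      ∀ N, ∑ n ∈ Finset.range N, ‖c n‖ ^ 2 ≤
        circAvg fun θ => ‖q (Complex.exp (θ * Complex.I))‖ := by
  have hE : ∀ θ : ℝ, ‖Complex.exp (θ * Complex.I)‖ = 1 := Complex.norm_exp_ofReal_mul_I
  set c : ℕ → ℂ := fun n => (n.factorial : ℂ)⁻¹ * iteratedDeriv n u 0 with hc
  have hsum : ∀ z, ‖z‖ < 1 → HasSum (fun n => c n * z ^ n) (u z) := fun z hz => by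
    have h := Complex.hasSum_taylorSeries_on_ball hu (z := z) (by simpa using hz)
    simp only [sub_zero, smul_eq_mul] at h
    have h' : (fun n => c n * z ^ n) =
        fun n => (n.factorial : ℂ)⁻¹ * (z ^ n * iteratedDeriv n u 0) := by
      funext n
      simp only [hc]
      ring
    rwa [h']
  refine ⟨c, hsum, fun N => ?_⟩
  have hbd : ∀ r : ℝ, 0 ≤ r → r < 1 → ∑ n ∈ Finset.range N, (‖c n‖ * r ^ n) ^ 2 ≤
      circAvg fun θ => ‖q (r * Complex.exp (θ * Complex.I))‖ := fun r hr0 hr1 => by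
    have hrE : ∀ θ : ℝ, ‖(r : ℂ) * Complex.exp (θ * Complex.I)‖ < 1 := fun θ => by
      simpa [hE, abs_of_nonneg hr0] using hr1
    have hb : Summable fun n => ‖c n * (r : ℂ) ^ n‖ :=
      (hsum r (by simpa [abs_of_nonneg hr0] using hr1)).summable.norm
    have hP := circAvg_norm_sq_tsum hb
    have hueq : ∀ θ : ℝ, ∑' n, c n * (r : ℂ) ^ n * Complex.exp (θ * Complex.I) ^ n =
        u (r * Complex.exp (θ * Complex.I)) := fun θ => by
      rw [← (hsum _ (hrE θ)).tsum_eq]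
      exact tsum_congr fun n => by rw [mul_pow]; ring
    simp only [hueq] at hP
    calc ∑ n ∈ Finset.range N, (‖c n‖ * r ^ n) ^ 2
        = ∑ n ∈ Finset.range N, ‖c n * (r : ℂ) ^ n‖ ^ 2 := by
          simp [abs_of_nonneg hr0]
      _ ≤ ∑' n, ‖c n * (r : ℂ) ^ n‖ ^ 2 := hb.norm_sq_of_norm.sum_le_tsum _ fun n _ => by positivity
      _ = _ := hP.symm
      _ ≤ _ := by
        refine circAvg_mono ?_ (by fun_prop) fun θ => huq _ (hrE θ)
        refine (Continuous.norm ?_).pow 2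
        refine hu.continuousOn.comp_continuous (by fun_prop) fun θ => by simpa using hrE θ
  have hcont : Continuous fun r : ℝ => circAvg fun θ => ‖q (r * Complex.exp (θ * Complex.I))‖ := by
    unfold circAvg
    refine continuous_const.mul
      (intervalIntegral.continuous_parametric_intervalIntegral_of_continuous' ?_ _ _)
    unfold Function.uncurry
    fun_prop
  have h1 : Filter.Tendsto (fun r : ℝ => ∑ n ∈ Finset.range N, (‖c n‖ * r ^ n) ^ 2)
      (nhdsWithin 1 (Set.Iio 1)) (nhds (∑ n ∈ Finset.range N, (‖c n‖ * 1 ^ n) ^ 2)) :=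
    ((by fun_prop : Continuous fun r : ℝ =>
      ∑ n ∈ Finset.range N, (‖c n‖ * r ^ n) ^ 2).tendsto 1).mono_left nhdsWithin_le_nhds
  have h2 := (hcont.tendsto 1).mono_left (nhdsWithin_le_nhds (s := Set.Iio 1))
  have h3 := le_of_tendsto_of_tendsto h1 h2 (by
    filter_upwards [Ioo_mem_nhdsLT (zero_lt_one' ℝ)] with r hr
    exact hbd r hr.1.le hr.2)
  simpa using h3

/-- Every polynomial is the product of two power series whose squared `ℓ²` norms are at most the
`L¹` norm of the polynomial on the unit circle. -/
lemma exists_polynomial_factorization (p : Polynomial ℂ) :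
    ∃ u v : ℕ → ℂ,
      (∀ N, ∑ n ∈ Finset.range N, ‖u n‖ ^ 2 ≤
        circAvg fun θ => ‖p.eval (Complex.exp (θ * Complex.I))‖) ∧
      (∀ N, ∑ n ∈ Finset.range N, ‖v n‖ ^ 2 ≤
        circAvg fun θ => ‖p.eval (Complex.exp (θ * Complex.I))‖) ∧
      ∀ n, p.coeff n = ∑ k ∈ Finset.range (n + 1), u k * v (n - k) := by
  have hE : ∀ θ : ℝ, ‖Complex.exp (θ * Complex.I)‖ = 1 := Complex.norm_exp_ofReal_mul_I
  have heval : ∀ z, p.eval z = p.leadingCoeff * (p.roots.map fun a => z - a).prod :=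
    (IsAlgClosed.splits p).eval_eq_prod_roots
  obtain ⟨U, V, q, hU, hV, hq, hUV, hUq, hVq, hqc⟩ :=
    exists_holomorphic_factorization p.leadingCoeff p.roots
  obtain ⟨u, hu, hu2⟩ := exists_coeff_of_norm_sq_le hU hq hUq
  obtain ⟨v, hv, hv2⟩ := exists_coeff_of_norm_sq_le hV hq hVq
  have hL : (fun θ : ℝ => ‖q (Complex.exp (θ * Complex.I))‖) =
      fun θ : ℝ => ‖p.eval (Complex.exp (θ * Complex.I))‖ := by
    funext θ
    rw [hqc _ (hE θ), heval]
  rw [hL] at hu2 hv2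
  refine ⟨u, v, hu2, hv2, fun n => ?_⟩
  have hpsum : ∀ z : ℂ, HasSum (fun n => p.coeff n * z ^ n) (p.eval z) := fun z => by
    rw [Polynomial.eval_eq_sum_range]
    refine hasSum_sum_of_ne_finset_zero fun n hn => ?_
    rw [Polynomial.coeff_eq_zero_of_natDegree_lt (by simpa using hn), zero_mul]
  refine eq_of_tsum_circle_eq (a := p.coeff)
    (b := fun n => ∑ k ∈ Finset.range (n + 1), u k * v (n - k)) (r := 1 / 2) (by norm_num) ?_ ?_ (fun θ => ?_) n
  · simpa using (hpsum (1 / 2)).summable.norm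
  · have := summable_norm_sum_mul_range_of_summable_norm
      (hu (1 / 2) (by norm_num)).summable.norm (hv (1 / 2) (by norm_num)).summable.norm
    simp only [sum_mul_pow_mul_pow] at this
    simpa using this
  · have hz : ‖((1 / 2 : ℝ) : ℂ) * Complex.exp (θ * Complex.I)‖ < 1 := by
      rw [norm_mul, hE]
      norm_num
    rw [(hpsum _).tsum_eq, heval, ← hUV _ hz, ← (hu _ hz).tsum_eq, ← (hv _ hz).tsum_eq,
      tsum_mul_tsum_eq_tsum_sum_range_of_summable_norm (hu _ hz).summable.norm
        (hv _ hz).summable.norm]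
    exact tsum_congr fun n => sum_mul_pow_mul_pow u v _ n

/-- The dilates of a function with bounded circular means factor, up to a given degree, with
`ℓ²` norms controlled uniformly. -/
lemma exists_truncated_factorization {a : ℕ → ℂ} {M r : ℝ} (hr0 : 0 < r)
    (ha : Summable fun n => r ^ n * ‖a n‖)
    (hM : circAvg (fun θ => ‖∑' n, a n * (r * Complex.exp (θ * Complex.I)) ^ n‖) ≤ M) (k : ℕ) :
    ∃ u v : ℕ → ℂ, (∀ N, ∑ n ∈ Finset.range N, ‖u n‖ ^ 2 ≤ M + 1) ∧
      (∀ N, ∑ n ∈ Finset.range N, ‖v n‖ ^ 2 ≤ M + 1) ∧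
      ∀ n ≤ k, a n * (r : ℂ) ^ n = ∑ i ∈ Finset.range (n + 1), u i * v (n - i) := by
  have hE : ∀ θ : ℝ, ‖Complex.exp (θ * Complex.I)‖ = 1 := Complex.norm_exp_ofReal_mul_I
  have htail := (tendsto_sum_nat_add fun n => r ^ n * ‖a n‖).eventually_le_const zero_lt_one
  obtain ⟨N, hN1, hNk⟩ := (htail.and (Filter.eventually_gt_atTop k)).exists
  set p : Polynomial ℂ :=
    ∑ n ∈ Finset.range N, Polynomial.C (a n * (r : ℂ) ^ n) * Polynomial.X ^ n with hp
  have hpc : ∀ n ≤ k, p.coeff n = a n * (r : ℂ) ^ n := fun n hn => by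
    simp only [hp, Polynomial.finsetSum_coeff, Polynomial.coeff_C_mul_X_pow]
    rw [Finset.sum_ite_eq, if_pos (Finset.mem_range.2 (by omega))]
  have hnorm : ∀ (θ : ℝ) (n : ℕ),
      ‖a n * (r * Complex.exp (θ * Complex.I)) ^ n‖ = r ^ n * ‖a n‖ := fun θ n => by
    rw [norm_mul, norm_pow, norm_mul, hE, Complex.norm_real, Real.norm_of_nonneg hr0.le, mul_one,
      mul_comm]
  have hs : ∀ θ : ℝ, Summable fun n => ‖a n * (r * Complex.exp (θ * Complex.I)) ^ n‖ := fun θ => by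
    simpa only [hnorm] using ha
  have hle : ∀ θ : ℝ, ‖p.eval (Complex.exp (θ * Complex.I))‖ ≤
      ‖∑' n, a n * (r * Complex.exp (θ * Complex.I)) ^ n‖ + 1 := fun θ => by
    have h1 := (hs θ).of_norm.sum_add_tsum_nat_add N
    have h2 : p.eval (Complex.exp (θ * Complex.I)) =
        ∑ n ∈ Finset.range N, a n * (r * Complex.exp (θ * Complex.I)) ^ n := by
      simp only [hp, Polynomial.eval_finsetSum, Polynomial.eval_mul, Polynomial.eval_C,
        Polynomial.eval_pow, Polynomial.eval_X, mul_pow, mul_assoc]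
    rw [h2, eq_sub_of_add_eq h1]
    refine (norm_sub_le _ _).trans (add_le_add le_rfl ?_)
    have h3 : Summable fun n => ‖a (n + N) * (r * Complex.exp (θ * Complex.I)) ^ (n + N)‖ :=
      (hs θ).comp_injective (add_left_injective N)
    refine (norm_tsum_le_tsum_norm h3).trans ?_
    simpa only [hnorm] using hN1
  have hcont : Continuous fun θ : ℝ => ‖∑' n, a n * (r * Complex.exp (θ * Complex.I)) ^ n‖ :=
    (continuous_tsum (fun n => by fun_prop) ha fun n θ => (hnorm θ n).le).norm
  have hL : circAvg (fun θ => ‖p.eval (Complex.exp (θ * Complex.I))‖) ≤ M + 1 := by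
    refine (circAvg_mono
      (h := fun θ => ‖∑' n, a n * (r * Complex.exp (θ * Complex.I)) ^ n‖ + 1)
      ?_ (hcont.add continuous_const) hle).trans ?_
    · exact (p.continuous.comp (by fun_prop)).norm
    · rw [circAvg_add hcont continuous_const, circAvg_const]
      linarith
  obtain ⟨u, v, hu, hv, huv⟩ := exists_polynomial_factorization p
  exact ⟨u, v, fun N => (hu N).trans hL, fun N => (hv N).trans hL, fun n hn => by
    rw [← hpc n hn, huv]⟩

/-- Coefficient sequences with bounded circular means are Cauchy products of two `ℓ²` sequences. -/
lemma exists_factorization_of_circAvg_le {a : ℕ → ℂ} {M : ℝ}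
    (ha : ∀ r : ℝ, 0 ≤ r → r < 1 → Summable fun n => r ^ n * ‖a n‖)
    (hM : ∀ r : ℝ, 0 < r → r < 1 →
      circAvg (fun θ => ‖∑' n, a n * (r * Complex.exp (θ * Complex.I)) ^ n‖) ≤ M) :
    ∃ u v : ℕ → ℂ, Summable (fun n => ‖u n‖ ^ 2) ∧ Summable (fun n => ‖v n‖ ^ 2) ∧
      ∀ n, a n = ∑ k ∈ Finset.range (n + 1), u k * v (n - k) := by
  set r : ℕ → ℝ := fun k => 1 - 1 / ((k : ℝ) + 1 + 1) with hrdef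
  have hrlim : Filter.Tendsto r Filter.atTop (nhds 1) := by
    have := (tendsto_const_nhds (x := (1 : ℝ))).sub
      ((tendsto_one_div_add_atTop_nhds_zero_nat (𝕜 := ℝ)).comp (Filter.tendsto_add_atTop_nat 1))
    simpa [hrdef, Function.comp_def] using this
  have hr : ∀ k, 0 < r k ∧ r k < 1 := fun k => by
    have h1 : (1 : ℝ) < k + 1 + 1 := by linarith [Nat.cast_nonneg (α := ℝ) k, show (k : ℝ) + 1 + 1 = k + 2 by ring]
    have h2 : 1 / ((k : ℝ) + 1 + 1) < 1 := (div_lt_one (by linarith)).2 h1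
    have h3 : 0 < 1 / ((k : ℝ) + 1 + 1) := by positivity
    constructor <;> simp only [hrdef] <;> linarith
  choose u v hu hv huv using fun k => exists_truncated_factorization (hr k).1
    (ha _ (hr k).1.le (hr k).2) (hM _ (hr k).1 (hr k).2) k
  set K : Set (ℕ → ℂ) := Set.univ.pi fun _ => Metric.closedBall 0 √(M + 1) with hK
  have hKc : IsCompact K := isCompact_univ_pi fun _ => isCompact_closedBall _ _
  have hmem : ∀ w : ℕ → ℂ, (∀ N, ∑ n ∈ Finset.range N, ‖w n‖ ^ 2 ≤ M + 1) → w ∈ K := fun w hw => by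
    intro n _
    rw [mem_closedBall_zero_iff]
    refine Real.le_sqrt_of_sq_le ((Finset.single_le_sum (f := fun n => ‖w n‖ ^ 2)
      (fun _ _ => by positivity) (Finset.self_mem_range_succ n)).trans (hw (n + 1)))
  obtain ⟨⟨U, V⟩, -, φ, hφ, hlim⟩ := (hKc.prod hKc).tendsto_subseq
    (x := fun k => (u k, v k)) fun k => ⟨hmem _ (hu k), hmem _ (hv k)⟩
  have hU : ∀ n, Filter.Tendsto (fun k => u (φ k) n) Filter.atTop (nhds (U n)) := fun n =>
    tendsto_pi_nhds.1 ((Prod.tendsto_iff _ _).1 hlim).1 n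
  have hV : ∀ n, Filter.Tendsto (fun k => v (φ k) n) Filter.atTop (nhds (V n)) := fun n =>
    tendsto_pi_nhds.1 ((Prod.tendsto_iff _ _).1 hlim).2 n
  refine ⟨U, V, ?_, ?_, fun n => ?_⟩
  · exact summable_of_sum_range_le (c := M + 1) (fun n => by positivity) fun N =>
      le_of_tendsto' (tendsto_finsetSum _ fun n _ => (hU n).norm.pow 2) fun k => hu (φ k) N
  · exact summable_of_sum_range_le (c := M + 1) (fun n => by positivity) fun N =>
      le_of_tendsto' (tendsto_finsetSum _ fun n _ => (hV n).norm.pow 2) fun k => hv (φ k) N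
  · have h1 : Filter.Tendsto (fun k => ∑ i ∈ Finset.range (n + 1), u (φ k) i * v (φ k) (n - i))
        Filter.atTop (nhds (∑ i ∈ Finset.range (n + 1), U i * V (n - i))) :=
      tendsto_finsetSum _ fun i _ => (hU i).mul (hV (n - i))
    have h2 : Filter.Tendsto (fun k => a n * ((r (φ k) : ℝ) : ℂ) ^ n) Filter.atTop
        (nhds (a n * ((1 : ℝ) : ℂ) ^ n)) :=
      ((Complex.continuous_ofReal.tendsto 1).comp (hrlim.comp hφ.tendsto_atTop)).pow n
        |>.const_mul (a n)
    have h3 := tendsto_nhds_unique_of_eventuallyEq h2 h1 (by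
      filter_upwards [Filter.eventually_ge_atTop n] with k hk
      exact huv (φ k) n (hk.trans hφ.le_apply))
    simpa using h3

lemma Summable.norm_mul_pow_of_norm_sq {E : Type*} [SeminormedAddCommGroup E] {F : ℕ → E} {r : ℝ}
    (hr0 : 0 ≤ r) (hr1 : r < 1) (hF : Summable fun n => ‖F n‖ ^ 2) :
    Summable fun n => ‖F n‖ * r ^ n := by
  refine Summable.of_nonneg_of_le (fun n => by positivity) (fun n => ?_)
    (hF.add (summable_geometric_of_lt_one (by positivity) (by nlinarith : r ^ 2 < 1)))
  have h1 : (r ^ 2) ^ n = (r ^ n) ^ 2 := by ring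
  rw [h1]
  nlinarith [sq_nonneg (‖F n‖ - r ^ n), sq_nonneg (‖F n‖ + r ^ n)]

lemma norm_mul_circle_pow {r : ℝ} (hr : 0 ≤ r) (c : ℂ) (θ : ℝ) (n : ℕ) :
    ‖c * (r * Complex.exp (θ * Complex.I)) ^ n‖ = ‖c‖ * r ^ n := by
  rw [norm_mul, norm_pow, norm_mul, Complex.norm_exp_ofReal_mul_I, Complex.norm_real,
    Real.norm_of_nonneg hr, mul_one]

lemma continuous_tsum_circle {a : ℕ → ℂ} {r : ℝ} (hr : 0 ≤ r)
    (ha : Summable fun n => ‖a n‖ * r ^ n) :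
    Continuous fun θ : ℝ => ∑' n, a n * (r * Complex.exp (θ * Complex.I)) ^ n :=
  continuous_tsum (fun n => by fun_prop) ha fun n θ => (norm_mul_circle_pow hr _ θ n).le

/-- Circular quadratic means of an `ℓ²` power series. -/
lemma circAvg_norm_sq_le {F : ℕ → ℂ} {A r : ℝ} (hr0 : 0 < r) (hr1 : r < 1)
    (hF : Summable fun n => ‖F n‖ ^ 2) (hA : ∑' n, ‖F n‖ ^ 2 ≤ A) :
    circAvg (fun θ => ‖∑' n, F n * (r * Complex.exp (θ * Complex.I)) ^ n‖ ^ 2) ≤ A := by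
  have hn : ∀ n, ‖F n * (r : ℂ) ^ n‖ = ‖F n‖ * r ^ n := fun n => by
    rw [norm_mul, norm_pow, Complex.norm_real, Real.norm_of_nonneg hr0.le]
  have hs : Summable fun n => ‖F n * (r : ℂ) ^ n‖ := by
    simpa only [hn] using hF.norm_mul_pow_of_norm_sq hr0.le hr1
  have h := circAvg_norm_sq_tsum hs
  simp only [mul_assoc, ← mul_pow] at h
  rw [h]
  refine (hs.norm_sq_of_norm.tsum_le_tsum (fun n => ?_) hF).trans hA
  rw [hn]
  gcongr
  exact mul_le_of_le_one_right (norm_nonneg _) (pow_le_one₀ hr0.le hr1.le)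

lemma circAvg_norm_cauchyProduct_le {F G : ℕ → ℂ} {A B r : ℝ} (hr0 : 0 < r) (hr1 : r < 1)
    (hF : Summable fun n => ‖F n‖ ^ 2) (hG : Summable fun n => ‖G n‖ ^ 2)
    (hA0 : 0 ≤ A) (hB0 : 0 ≤ B) (hA : ∑' n, ‖F n‖ ^ 2 ≤ A ^ 2) (hB : ∑' n, ‖G n‖ ^ 2 ≤ B ^ 2) :
    (Summable fun n => ‖∑ k ∈ Finset.range (n + 1), F k * G (n - k)‖ * r ^ n) ∧
    circAvg (fun θ => ‖∑' n, (∑ k ∈ Finset.range (n + 1), F k * G (n - k)) *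
      (r * Complex.exp (θ * Complex.I)) ^ n‖) ≤ A * B := by
  have hFr := hF.norm_mul_pow_of_norm_sq hr0.le hr1
  have hGr := hG.norm_mul_pow_of_norm_sq hr0.le hr1
  have hs : ∀ {H : ℕ → ℂ}, (Summable fun n => ‖H n‖ * r ^ n) → ∀ θ : ℝ,
      Summable fun n => ‖H n * (r * Complex.exp (θ * Complex.I)) ^ n‖ := fun h θ => by
    simpa only [norm_mul_circle_pow hr0.le] using h
  constructor
  · have := summable_norm_sum_mul_range_of_summable_norm (hs hFr 0) (hs hGr 0)
    simpa only [sum_mul_pow_mul_pow, norm_mul_circle_pow hr0.le] using this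
  · have h1 : ∀ θ : ℝ, ‖∑' n, (∑ k ∈ Finset.range (n + 1), F k * G (n - k)) *
        (r * Complex.exp (θ * Complex.I)) ^ n‖ =
        ‖∑' n, F n * (r * Complex.exp (θ * Complex.I)) ^ n‖ *
          ‖∑' n, G n * (r * Complex.exp (θ * Complex.I)) ^ n‖ := fun θ => by
      rw [← norm_mul, tsum_mul_tsum_eq_tsum_sum_range_of_summable_norm (hs hFr θ) (hs hGr θ)]
      simp only [sum_mul_pow_mul_pow]
    simp only [h1]
    have hcF := (continuous_tsum_circle hr0.le hFr).norm
    have hcG := (continuous_tsum_circle hr0.le hGr).norm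
    refine abs_le_of_sq_le_sq' ?_ (mul_nonneg hA0 hB0) |>.2
    rw [mul_pow]
    refine (circAvg_mul_sq_le hcF hcG).trans ?_
    exact mul_le_mul (circAvg_norm_sq_le hr0 hr1 hF hA) (circAvg_norm_sq_le hr0 hr1 hG hB)
      (circAvg_nonneg (hcG.pow 2) fun θ => by positivity) (by positivity)

/-- The component `z` in the decomposition `q = z + w j` with `z w : ℂ`. -/
noncomputable def Quaternion.fstComplex : ℍ[ℝ] →L[ℝ] ℂ :=
  LinearMap.toContinuousLinearMap
    { toFun := fun q => ⟨q.re, q.imI⟩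
      map_add' := fun p q => by apply Complex.ext <;> simp
      map_smul' := fun c q => by apply Complex.ext <;> simp }

/-- The component `w` in the decomposition `q = z + w j` with `z w : ℂ`. -/
noncomputable def Quaternion.sndComplex : ℍ[ℝ] →L[ℝ] ℂ :=
  LinearMap.toContinuousLinearMap
    { toFun := fun q => ⟨q.imJ, q.imK⟩
      map_add' := fun p q => by apply Complex.ext <;> simp
      map_smul' := fun c q => by apply Complex.ext <;> simp }

namespace Quaternion

lemma fstComplex_apply (q : ℍ[ℝ]) : fstComplex q = ⟨q.re, q.imI⟩ := rfl

lemma sndComplex_apply (q : ℍ[ℝ]) : sndComplex q = ⟨q.imJ, q.imK⟩ := rfl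

lemma fstComplex_coe_mul (z : ℂ) (q : ℍ[ℝ]) : fstComplex (z * q) = z * fstComplex q := by
  apply Complex.ext <;> simp [fstComplex_apply, re_mul, imI_mul]

lemma sndComplex_coe_mul (z : ℂ) (q : ℍ[ℝ]) : sndComplex (z * q) = z * sndComplex q := by
  apply Complex.ext <;> simp [sndComplex_apply, imJ_mul, imK_mul]

lemma fstComplex_mul (p q : ℍ[ℝ]) :
    fstComplex (p * q) = fstComplex p * fstComplex q - sndComplex p * star (sndComplex q) := by
  apply Complex.ext <;> simp [fstComplex_apply, sndComplex_apply, re_mul, imI_mul] <;> ring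

lemma sndComplex_mul (p q : ℍ[ℝ]) :
    sndComplex (p * q) = fstComplex p * sndComplex q + sndComplex p * star (fstComplex q) := by
  apply Complex.ext <;> simp [fstComplex_apply, sndComplex_apply, imJ_mul, imK_mul] <;> ring

lemma norm_sq_eq_components (q : ℍ[ℝ]) : ‖q‖ ^ 2 = ‖fstComplex q‖ ^ 2 + ‖sndComplex q‖ ^ 2 := by
  rw [sq ‖q‖, ← normSq_eq_norm_mul_self, normSq_def', Complex.sq_norm, Complex.sq_norm,
    Complex.normSq_apply, Complex.normSq_apply, fstComplex_apply, sndComplex_apply]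
  ring

lemma norm_fstComplex_le (q : ℍ[ℝ]) : ‖fstComplex q‖ ≤ ‖q‖ :=
  abs_le_of_sq_le_sq' (by nlinarith [norm_sq_eq_components q, sq_nonneg ‖sndComplex q‖])
    (norm_nonneg _) |>.2

lemma norm_sndComplex_le (q : ℍ[ℝ]) : ‖sndComplex q‖ ≤ ‖q‖ :=
  abs_le_of_sq_le_sq' (by nlinarith [norm_sq_eq_components q, sq_nonneg ‖fstComplex q‖])
    (norm_nonneg _) |>.2

lemma norm_le_components (q : ℍ[ℝ]) : ‖q‖ ≤ ‖fstComplex q‖ + ‖sndComplex q‖ := by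
  have h := mul_nonneg (norm_nonneg (fstComplex q)) (norm_nonneg (sndComplex q))
  exact abs_le_of_sq_le_sq' (by nlinarith [norm_sq_eq_components q]) (by positivity) |>.2

/-- The imaginary unit `j`. -/
def unitJ : ℍ[ℝ] := ⟨0, 0, 1, 0⟩

@[simp] lemma re_unitJ : unitJ.re = 0 := rfl

@[simp] lemma imI_unitJ : unitJ.imI = 0 := rfl

@[simp] lemma imJ_unitJ : unitJ.imJ = 1 := rfl

@[simp] lemma imK_unitJ : unitJ.imK = 0 := rfl

lemma coe_fst_add_coe_snd_mul (q : ℍ[ℝ]) :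
    (fstComplex q : ℍ[ℝ]) + (sndComplex q : ℍ[ℝ]) * unitJ = q := by
  ext <;> simp [fstComplex_apply, sndComplex_apply, re_mul, imI_mul, imJ_mul, imK_mul]

lemma norm_coeComplex (z : ℂ) : ‖(z : ℍ[ℝ])‖ = ‖z‖ := by
  rw [← sq_eq_sq₀ (norm_nonneg _) (norm_nonneg _), norm_sq_eq_components]
  simp [fstComplex_apply, sndComplex_apply, Complex.sq_norm, Complex.normSq_apply]

lemma norm_unitJ : ‖unitJ‖ = 1 := by
  rw [← sq_eq_sq₀ (norm_nonneg _) zero_le_one, sq ‖_‖, ← normSq_eq_norm_mul_self, normSq_def']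
  simp

lemma coeComplex_pow (z : ℂ) (n : ℕ) : ((z ^ n : ℂ) : ℍ[ℝ]) = (z : ℍ[ℝ]) ^ n :=
  map_pow ofComplex z n

/-- Every imaginary unit is conjugate to `i`. -/
lemma exists_conj_unitI {I : ℍ[ℝ]} (h0 : I.re = 0) (h1 : ‖I‖ = 1) :
    ∃ u : ℍ[ℝ], ‖u‖ = 1 ∧ I * u = u * (Complex.I : ℍ[ℝ]) := by
  have hsq : I.imI ^ 2 + I.imJ ^ 2 + I.imK ^ 2 = 1 := by
    have := normSq_eq_norm_mul_self I
    rw [normSq_def', h1, h0] at this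
    linarith
  have hne : ∃ u : ℍ[ℝ], u ≠ 0 ∧ I * u = u * (Complex.I : ℍ[ℝ]) := by
    by_cases hI : I + (Complex.I : ℍ[ℝ]) = 0
    · refine ⟨unitJ, fun h => by simpa using congrArg (fun q : ℍ[ℝ] => q.imJ) h, ?_⟩
      rw [eq_neg_of_add_eq_zero_left hI]
      ext <;> simp [re_mul, imI_mul, imJ_mul, imK_mul]
    · refine ⟨I + (Complex.I : ℍ[ℝ]), hI, ?_⟩
      have hII : I * I = -1 := by
        ext <;> simp [re_mul, imI_mul, imJ_mul, imK_mul, h0] <;> linarith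
      have hii : (Complex.I : ℍ[ℝ]) * (Complex.I : ℍ[ℝ]) = -1 := by
        ext <;> simp [re_mul, imI_mul, imJ_mul, imK_mul]
      rw [mul_add, add_mul, hII, hii, add_comm]
  obtain ⟨u, hu0, hu⟩ := hne
  refine ⟨‖u‖⁻¹ • u, ?_, ?_⟩
  · rw [norm_smul, norm_inv, norm_norm, inv_mul_cancel₀ (norm_ne_zero_iff.2 hu0)]
  · rw [mul_smul_comm, hu, smul_mul_assoc]

lemma expQ_unitI (θ : ℝ) :
    expQ (Complex.I : ℍ[ℝ]) θ = ((Complex.exp (θ * Complex.I) : ℂ) : ℍ[ℝ]) := by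
  ext <;> simp [expQ, Complex.exp_ofReal_mul_I_re, Complex.exp_ofReal_mul_I_im]

lemma smul_expQ_unitI (r θ : ℝ) :
    r • expQ (Complex.I : ℍ[ℝ]) θ = ((r * Complex.exp (θ * Complex.I) : ℂ) : ℍ[ℝ]) := by
  rw [expQ_unitI, coeComplex_mul, coeComplex_coe, coe_mul_eq_smul]

lemma smul_expQ_pow {I u : ℍ[ℝ]} (hu : ‖u‖ = 1) (h : I * u = u * (Complex.I : ℍ[ℝ])) (r θ : ℝ) (n : ℕ) :
    (r • expQ I θ) ^ n = u * (r • expQ (Complex.I : ℍ[ℝ]) θ) ^ n * u⁻¹ := by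
  have hu0 : u ≠ 0 := norm_ne_zero_iff.1 (by rw [hu]; exact one_ne_zero)
  have h1 : (r • expQ I θ) * u = u * (r • expQ (Complex.I : ℍ[ℝ]) θ) := by
    simp only [expQ, smul_add, add_mul, mul_add, smul_mul_assoc, mul_smul_comm, h, one_mul, mul_one]
  have h2 : (r • expQ I θ) = u * (r • expQ (Complex.I : ℍ[ℝ]) θ) * u⁻¹ := by
    rw [← h1, mul_inv_cancel_right₀ hu0]
  rw [h2]
  induction n with
  | zero => simp [hu0]
  | succ n ih => rw [pow_succ, ih, pow_succ]; simp only [mul_assoc, inv_mul_cancel_left₀ hu0]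

end Quaternion

lemma norm_sum_range_mul_le {R : Type*} [NormedRing R] {F G : ℕ → R} {A B : ℝ}
    (hF : Summable fun n => ‖F n‖ ^ 2) (hG : Summable fun n => ‖G n‖ ^ 2)
    (hA0 : 0 ≤ A) (hB0 : 0 ≤ B) (hA : ∑' n, ‖F n‖ ^ 2 ≤ A ^ 2) (hB : ∑' n, ‖G n‖ ^ 2 ≤ B ^ 2)
    (n : ℕ) : ‖∑ k ∈ Finset.range (n + 1), F k * G (n - k)‖ ≤ A * B := by
  refine (norm_sum_le_of_le _ fun k _ => norm_mul_le _ _).trans ?_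
  refine (abs_le_of_sq_le_sq' ?_ (mul_nonneg hA0 hB0)).2
  refine (Finset.sum_mul_sq_le_sq_mul_sq _ _ _).trans ?_
  have h1 : ∑ k ∈ Finset.range (n + 1), ‖G (n - k)‖ ^ 2 = ∑ k ∈ Finset.range (n + 1), ‖G k‖ ^ 2 :=
    Finset.sum_range_reflect (fun k => ‖G k‖ ^ 2) (n + 1)
  rw [h1, mul_pow]
  exact mul_le_mul ((hF.sum_le_tsum _ fun _ _ => by positivity).trans hA)
    ((hG.sum_le_tsum _ fun _ _ => by positivity).trans hB) (by positivity) (by positivity)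

namespace Quaternion

lemma norm_smul_expQ_pow_mul {I : ℍ[ℝ]} (h0 : I.re = 0) (h1 : ‖I‖ = 1) {r : ℝ} (hr : 0 ≤ r)
    (θ : ℝ) (n : ℕ) (q : ℍ[ℝ]) : ‖(r • expQ I θ) ^ n * q‖ = r ^ n * ‖q‖ := by
  obtain ⟨u, hu, hIu⟩ := exists_conj_unitI h0 h1
  rw [smul_expQ_pow hu hIu, norm_mul, norm_mul, norm_mul, norm_inv, hu, norm_pow, smul_expQ_unitI,
    norm_coeComplex, norm_mul, Complex.norm_exp_ofReal_mul_I, Complex.norm_real,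
    Real.norm_of_nonneg hr]
  ring

lemma re_coe_I : ((Complex.I : ℂ) : ℍ[ℝ]).re = 0 := by simp

lemma norm_coe_I : ‖((Complex.I : ℂ) : ℍ[ℝ])‖ = 1 := by rw [norm_coeComplex, Complex.norm_I]

lemma continuous_tsum_slice {I : ℍ[ℝ]} (h0 : I.re = 0) (h1 : ‖I‖ = 1) {r : ℝ} (hr : 0 ≤ r)
    {g : ℕ → ℍ[ℝ]} (hg : Summable fun n => r ^ n * ‖g n‖) :
    Continuous fun θ : ℝ => ∑' n, (r • expQ I θ) ^ n * g n := by
  refine continuous_tsum (fun n => ?_) hg fun n θ => (norm_smul_expQ_pow_mul h0 h1 hr θ n _).le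
  unfold expQ
  fun_prop

lemma summable_slice {I : ℍ[ℝ]} (h0 : I.re = 0) (h1 : ‖I‖ = 1) {r : ℝ} (hr : 0 ≤ r)
    {g : ℕ → ℍ[ℝ]} (hg : Summable fun n => r ^ n * ‖g n‖) (θ : ℝ) :
    Summable fun n => (r • expQ I θ) ^ n * g n :=
  Summable.of_norm (by simpa only [norm_smul_expQ_pow_mul h0 h1 hr] using hg)

lemma fstComplex_tsum_slice {r : ℝ} (hr : 0 ≤ r) {g : ℕ → ℍ[ℝ]}
    (hg : Summable fun n => r ^ n * ‖g n‖) (θ : ℝ) :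
    fstComplex (∑' n, (r • expQ (Complex.I : ℍ[ℝ]) θ) ^ n * g n) =
      ∑' n, fstComplex (g n) * (r * Complex.exp (θ * Complex.I)) ^ n := by
  rw [fstComplex.map_tsum (summable_slice re_coe_I norm_coe_I hr hg θ)]
  refine tsum_congr fun n => ?_
  rw [smul_expQ_unitI, ← coeComplex_pow, fstComplex_coe_mul, mul_comm]

lemma sndComplex_tsum_slice {r : ℝ} (hr : 0 ≤ r) {g : ℕ → ℍ[ℝ]}
    (hg : Summable fun n => r ^ n * ‖g n‖) (θ : ℝ) :
    sndComplex (∑' n, (r • expQ (Complex.I : ℍ[ℝ]) θ) ^ n * g n) =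
      ∑' n, sndComplex (g n) * (r * Complex.exp (θ * Complex.I)) ^ n := by
  rw [sndComplex.map_tsum (summable_slice re_coe_I norm_coe_I hr hg θ)]
  refine tsum_congr fun n => ?_
  rw [smul_expQ_unitI, ← coeComplex_pow, sndComplex_coe_mul, mul_comm]

lemma summable_cauchyProduct_slice {F G : ℕ → ℍ[ℝ]} {A B r : ℝ} (hr0 : 0 < r) (hr1 : r < 1)
    (hF : Summable fun n => ‖F n‖ ^ 2) (hG : Summable fun n => ‖G n‖ ^ 2)
    (hA0 : 0 ≤ A) (hB0 : 0 ≤ B) (hA : ∑' n, ‖F n‖ ^ 2 ≤ A ^ 2) (hB : ∑' n, ‖G n‖ ^ 2 ≤ B ^ 2) :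
    Summable fun n => r ^ n * ‖∑ k ∈ Finset.range (n + 1), F k * G (n - k)‖ := by
  refine Summable.of_nonneg_of_le (fun n => by positivity) (fun n => ?_)
    ((summable_geometric_of_lt_one hr0.le hr1).mul_right (A * B))
  gcongr
  exact norm_sum_range_mul_le hF hG hA0 hB0 hA hB n

/-- The `L¹` mean of a `⋆`-product on the slice of `i`. -/
lemma circAvg_norm_star_unitI_le {F G : ℕ → ℍ[ℝ]} {A B r : ℝ} (hr0 : 0 < r) (hr1 : r < 1)
    (hF : Summable fun n => ‖F n‖ ^ 2) (hG : Summable fun n => ‖G n‖ ^ 2)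
    (hA0 : 0 ≤ A) (hB0 : 0 ≤ B) (hA : ∑' n, ‖F n‖ ^ 2 ≤ A ^ 2) (hB : ∑' n, ‖G n‖ ^ 2 ≤ B ^ 2) :
    circAvg (fun θ => ‖∑' n, (r • expQ (Complex.I : ℍ[ℝ]) θ) ^ n *
      ∑ k ∈ Finset.range (n + 1), F k * G (n - k)‖) ≤ 4 * (A * B) := by
  have hg := summable_cauchyProduct_slice hr0 hr1 hF hG hA0 hB0 hA hB
  have hsub : ∀ {H : ℕ → ℍ[ℝ]} {C : ℝ} (L : ℍ[ℝ] → ℂ), (∀ q, ‖L q‖ ≤ ‖q‖) →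
      (Summable fun n => ‖H n‖ ^ 2) → ∑' n, ‖H n‖ ^ 2 ≤ C →
      (Summable fun n => ‖L (H n)‖ ^ 2) ∧ ∑' n, ‖L (H n)‖ ^ 2 ≤ C := fun {H C} L hL hH hC => by
    have hle : ∀ n, ‖L (H n)‖ ^ 2 ≤ ‖H n‖ ^ 2 := fun n => by gcongr; exact hL _
    have hs := Summable.of_nonneg_of_le (fun n => by positivity) hle hH
    exact ⟨hs, (hs.tsum_le_tsum hle hH).trans hC⟩
  have hpair : ∀ L L' : ℍ[ℝ] → ℂ, (∀ q, ‖L q‖ ≤ ‖q‖) → (∀ q, ‖L' q‖ ≤ ‖q‖) → _ :=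
    fun L L' hL hL' => circAvg_norm_cauchyProduct_le hr0 hr1 (hsub L hL hF hA).1
      (hsub L' hL' hG hB).1 hA0 hB0 (hsub L hL hF hA).2 (hsub L' hL' hG hB).2
  have hstar₁ : ∀ q, ‖star (fstComplex q)‖ ≤ ‖q‖ := fun q => by
    rw [_root_.norm_star]; exact norm_fstComplex_le q
  have hstar₂ : ∀ q, ‖star (sndComplex q)‖ ≤ ‖q‖ := fun q => by
    rw [_root_.norm_star]; exact norm_sndComplex_le q
  obtain ⟨s₁, b₁⟩ := hpair (fun q => fstComplex q) (fun q => fstComplex q)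
    norm_fstComplex_le norm_fstComplex_le
  obtain ⟨s₂, b₂⟩ := hpair (fun q => sndComplex q) (fun q => star (sndComplex q))
    norm_sndComplex_le hstar₂
  obtain ⟨s₃, b₃⟩ := hpair (fun q => fstComplex q) (fun q => sndComplex q)
    norm_fstComplex_le norm_sndComplex_le
  obtain ⟨s₄, b₄⟩ := hpair (fun q => sndComplex q) (fun q => star (fstComplex q))
    norm_sndComplex_le hstar₁
  have hev : ∀ {a : ℕ → ℂ}, (Summable fun n => ‖a n‖ * r ^ n) → ∀ θ : ℝ,
      Summable fun n => a n * (r * Complex.exp (θ * Complex.I)) ^ n := fun ha θ =>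
    Summable.of_norm (by simpa only [norm_mul_circle_pow hr0.le] using ha)
  have c₁ := (continuous_tsum_circle hr0.le s₁).norm
  have c₂ := (continuous_tsum_circle hr0.le s₂).norm
  have c₃ := (continuous_tsum_circle hr0.le s₃).norm
  have c₄ := (continuous_tsum_circle hr0.le s₄).norm
  have hsum := circAvg_mono
    (continuous_tsum_slice re_coe_I norm_coe_I hr0.le hg).norm ((c₁.add c₂).add (c₃.add c₄))
    fun θ => by
      refine (norm_le_components _).trans (add_le_add ?_ ?_)
      · rw [fstComplex_tsum_slice hr0.le hg]
        simp only [map_sum, fstComplex_mul, Finset.sum_sub_distrib, sub_mul]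
        rw [(hev s₁ θ).tsum_sub (hev s₂ θ)]
        exact norm_sub_le _ _
      · rw [sndComplex_tsum_slice hr0.le hg]
        simp only [map_sum, sndComplex_mul, Finset.sum_add_distrib, add_mul]
        rw [(hev s₃ θ).tsum_add (hev s₄ θ)]
        exact norm_add_le _ _
  refine hsum.trans ?_
  have e₁ := circAvg_add (c₁.add c₂) (c₃.add c₄)
  have e₂ := circAvg_add c₁ c₂
  have e₃ := circAvg_add c₃ c₄
  refine (e₁.trans (congrArg₂ _ e₂ e₃)).le.trans ?_
  linarith

/-- The `L¹` mean of a `⋆`-product on an arbitrary slice. -/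
lemma circAvg_norm_star_le {I : ℍ[ℝ]} (h0 : I.re = 0) (h1 : ‖I‖ = 1) {F G : ℕ → ℍ[ℝ]} {A B r : ℝ}
    (hr0 : 0 < r) (hr1 : r < 1)
    (hF : Summable fun n => ‖F n‖ ^ 2) (hG : Summable fun n => ‖G n‖ ^ 2)
    (hA0 : 0 ≤ A) (hB0 : 0 ≤ B) (hA : ∑' n, ‖F n‖ ^ 2 ≤ A ^ 2) (hB : ∑' n, ‖G n‖ ^ 2 ≤ B ^ 2) :
    circAvg (fun θ => ‖∑' n, (r • expQ I θ) ^ n *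
      ∑ k ∈ Finset.range (n + 1), F k * G (n - k)‖) ≤ 4 * (A * B) := by
  obtain ⟨u, hu, hIu⟩ := exists_conj_unitI h0 h1
  have hn : ∀ n, ‖u⁻¹ * F n‖ = ‖F n‖ := fun n => by rw [norm_mul, norm_inv, hu, inv_one, one_mul]
  have h := circAvg_norm_star_unitI_le (F := fun n => u⁻¹ * F n) hr0 hr1
    (by simpa only [hn] using hF) hG hA0 hB0 (by simpa only [hn] using hA) hB
  convert h using 3 with θ
  rw [← one_mul ‖∑' n, (r • expQ (Complex.I : ℍ[ℝ]) θ) ^ n * _‖, ← hu, ← norm_mul,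
    ← tsum_mul_left]
  congr 1
  refine tsum_congr fun n => ?_
  rw [smul_expQ_pow hu hIu]
  simp only [mul_assoc, Finset.mul_sum]

end Quaternion

section

open Quaternion

lemma circAvg_norm_slice_tsum_le {I : ℍ[ℝ]} (h0 : I.re = 0) (h1 : ‖I‖ = 1) {r : ℝ} (hr0 : 0 < r)
    (hr1 : r < 1) {h : ℕ → ℕ → ℍ[ℝ]} {B : ℕ → ℝ} (hB : Summable B) (hhB : ∀ j n, ‖h j n‖ ≤ B j)
    {C : ℝ} (hC : ∀ j, circAvg (fun θ => ‖∑' n, (r • expQ I θ) ^ n * h j n‖) ≤ C * B j) :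
    circAvg (fun θ => ‖∑' n, (r • expQ I θ) ^ n * ∑' j, h j n‖) ≤ C * ∑' j, B j := by
  have hB0 : ∀ j, 0 ≤ B j := fun j => (norm_nonneg _).trans (hhB j 0)
  have hgeo := summable_geometric_of_lt_one hr0.le hr1
  have hrow : ∀ j, Summable fun n => r ^ n * ‖h j n‖ := fun j =>
    Summable.of_nonneg_of_le (fun n => by positivity)
      (fun n => mul_le_mul_of_nonneg_left (hhB j n) (by positivity)) (hgeo.mul_right (B j))
  have hcol : ∀ n, Summable fun j => h j n := fun n => Summable.of_norm_bounded hB fun j => hhB j n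
  have hdouble : Summable fun p : ℕ × ℕ => B p.1 * r ^ p.2 := by
    refine summable_mul_of_summable_norm (f := B) (g := fun n => r ^ n) ?_ ?_
    · simpa only [Real.norm_of_nonneg (hB0 _)] using hB
    · simpa [abs_of_pos hr0] using hgeo
  have hbound : ∀ (θ : ℝ) j n, ‖(r • expQ I θ) ^ n * h j n‖ ≤ B j * r ^ n := fun θ j n => by
    rw [norm_smul_expQ_pow_mul h0 h1 hr0.le, mul_comm]
    exact mul_le_mul_of_nonneg_right (hhB j n) (by positivity)
  have hswap : ∀ θ : ℝ, ∑' n, (r • expQ I θ) ^ n * ∑' j, h j n =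
      ∑' j, ∑' n, (r • expQ I θ) ^ n * h j n := fun θ => by
    rw [Summable.tsum_comm (f := fun n j => (r • expQ I θ) ^ n * h j n)]
    · exact tsum_congr fun n => ((hcol n).tsum_mul_left _).symm
    · refine Summable.of_norm_bounded hdouble.prod_symm fun p => ?_
      exact hbound θ p.2 p.1
  have hnb : ∀ (θ : ℝ) j, ‖∑' n, (r • expQ I θ) ^ n * h j n‖ ≤ B j * (1 - r)⁻¹ := fun θ j => by
    refine tsum_of_norm_bounded ?_ fun n => hbound θ j n
    exact (hasSum_geometric_of_lt_one hr0.le hr1).mul_left _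
  have hc : ∀ j, Continuous fun θ : ℝ => ‖∑' n, (r • expQ I θ) ^ n * h j n‖ := fun j =>
    (continuous_tsum_slice h0 h1 hr0.le (hrow j)).norm
  have hBr : Summable fun j => B j * (1 - r)⁻¹ := hB.mul_right _
  have hcs : Continuous fun θ : ℝ => ∑' j, ‖∑' n, (r • expQ I θ) ^ n * h j n‖ :=
    continuous_tsum hc hBr fun j θ => by rw [norm_norm]; exact hnb θ j
  have hint := intervalIntegral.hasSum_intervalIntegral_of_summable_norm
    (a := -Real.pi) (b := Real.pi) (f := fun j => ⟨_, hc j⟩) (by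
      refine Summable.of_nonneg_of_le (fun p => norm_nonneg _) (fun j => ?_) hBr
      rw [ContinuousMap.norm_le _ (mul_nonneg (hB0 j) (inv_nonneg.2 (by linarith)))]
      intro θ
      simpa using hnb θ j)
  have hint' := hint.mul_left (1 / (2 * Real.pi))
  have hcF : Continuous fun θ : ℝ => ‖∑' n, (r • expQ I θ) ^ n * ∑' j, h j n‖ := by
    simp only [hswap]
    refine (continuous_tsum (fun j => continuous_tsum_slice h0 h1 hr0.le (hrow j)) hBr
      fun j θ => hnb θ j).norm
  refine (circAvg_mono hcF hcs fun θ => ?_).trans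
    (hasSum_le hC hint' (hB.hasSum.mul_left C))
  rw [hswap]
  exact norm_tsum_le_tsum_norm
    (Summable.of_nonneg_of_le (fun _ => norm_nonneg _) (hnb θ) hBr)

lemma memH1_of_weak_star_product {f : ℕ → ℍ[ℝ]} {F G : ℕ → ℕ → ℍ[ℝ]}
    (hF : ∀ j : ℕ, Summable fun n => ‖F j n‖ ^ 2) (hG : ∀ j : ℕ, Summable fun n => ‖G j n‖ ^ 2)
    (hFG : Summable fun j : ℕ =>
      (∑' n : ℕ, ‖F j n‖ ^ 2) ^ (1 / 2 : ℝ) * (∑' n : ℕ, ‖G j n‖ ^ 2) ^ (1 / 2 : ℝ))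
    (hf : ∀ n, f n = ∑' j : ℕ, ∑ k ∈ Finset.range (n + 1), F j k * G j (n - k)) : MemH1 f := by
  refine ⟨4 * ∑' j : ℕ,
    (∑' n : ℕ, ‖F j n‖ ^ 2) ^ (1 / 2 : ℝ) * (∑' n : ℕ, ‖G j n‖ ^ 2) ^ (1 / 2 : ℝ),
    fun I h0 h1 r hr0 hr1 => ?_⟩
  have hrpow : ∀ H : ℕ → ℍ[ℝ], 0 ≤ (∑' n, ‖H n‖ ^ 2) ^ (1 / 2 : ℝ) ∧
      ∑' n, ‖H n‖ ^ 2 ≤ ((∑' n, ‖H n‖ ^ 2) ^ (1 / 2 : ℝ)) ^ 2 := fun H => by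
    have hs : 0 ≤ ∑' n, ‖H n‖ ^ 2 := tsum_nonneg fun n => by positivity
    rw [← Real.sqrt_eq_rpow, Real.sq_sqrt hs]
    exact ⟨Real.sqrt_nonneg _, le_rfl⟩
  simp only [hf]
  exact circAvg_norm_slice_tsum_le h0 h1 hr0 hr1 hFG
    (fun j n => norm_sum_range_mul_le (hF j) (hG j) (hrpow _).1 (hrpow _).1 (hrpow _).2
      (hrpow _).2 n)
    fun j => circAvg_norm_star_le h0 h1 hr0 hr1 (hF j) (hG j) (hrpow _).1 (hrpow _).1 (hrpow _).2
      (hrpow _).2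

lemma exists_factorization_components {f : ℕ → ℍ[ℝ]} {L : ℍ[ℝ] → ℂ} (hL : ∀ q, ‖L q‖ ≤ ‖q‖)
    (hconv : ∀ r : ℝ, 0 ≤ r → r < 1 → Summable fun n => r ^ n * ‖f n‖)
    (hLs : ∀ r : ℝ, 0 < r → r < 1 → ∀ θ : ℝ,
      L (∑' n, (r • expQ (Complex.I : ℍ[ℝ]) θ) ^ n * f n) =
        ∑' n, L (f n) * (r * Complex.exp (θ * Complex.I)) ^ n) (hf : MemH1 f) :
    ∃ u v : ℕ → ℂ, Summable (fun n => ‖u n‖ ^ 2) ∧ Summable (fun n => ‖v n‖ ^ 2) ∧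
      ∀ n, L (f n) = ∑ k ∈ Finset.range (n + 1), u k * v (n - k) := by
  obtain ⟨M, hM⟩ := hf
  have hs : ∀ r : ℝ, 0 ≤ r → r < 1 → Summable fun n => r ^ n * ‖L (f n)‖ := fun r hr0 hr1 =>
    Summable.of_nonneg_of_le (fun n => by positivity)
      (fun n => mul_le_mul_of_nonneg_left (hL _) (by positivity)) (hconv r hr0 hr1)
  refine exists_factorization_of_circAvg_le (M := M) hs fun r hr0 hr1 => ?_
  refine (circAvg_mono ?_ ?_ fun θ => ?_).trans (hM _ re_coe_I norm_coe_I r hr0 hr1)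
  · exact (continuous_tsum_circle hr0.le (by simpa only [mul_comm] using hs r hr0.le hr1)).norm
  · exact (continuous_tsum_slice re_coe_I norm_coe_I hr0.le (hconv r hr0.le hr1)).norm
  · rw [← hLs r hr0 hr1]
    exact hL _

lemma exists_weak_star_product_of_memH1 {f : ℕ → ℍ[ℝ]}
    (hconv : ∀ r : ℝ, 0 ≤ r → r < 1 → Summable fun n => r ^ n * ‖f n‖) (hf : MemH1 f) :
    ∃ F G : ℕ → ℕ → ℍ[ℝ],
      (∀ j : ℕ, Summable (fun n => ‖F j n‖ ^ 2)) ∧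
      (∀ j : ℕ, Summable (fun n => ‖G j n‖ ^ 2)) ∧
      (∀ j ∉ Finset.range 2, F j = 0) ∧
      ∀ n, f n = ∑ j ∈ Finset.range 2, ∑ k ∈ Finset.range (n + 1), F j k * G j (n - k) := by
  obtain ⟨u₁, v₁, hu₁, hv₁, h₁⟩ := exists_factorization_components norm_fstComplex_le hconv
    (fun r hr0 hr1 θ => fstComplex_tsum_slice hr0.le (hconv r hr0.le hr1) θ) hf
  obtain ⟨u₂, v₂, hu₂, hv₂, h₂⟩ := exists_factorization_components norm_sndComplex_le hconv
    (fun r hr0 hr1 θ => sndComplex_tsum_slice hr0.le (hconv r hr0.le hr1) θ) hf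
  refine ⟨fun j n => match j with
      | 0 => (u₁ n : ℍ[ℝ])
      | 1 => (u₂ n : ℍ[ℝ])
      | _ => 0, fun j n => match j with
      | 0 => (v₁ n : ℍ[ℝ])
      | 1 => (v₂ n : ℍ[ℝ]) * unitJ
      | _ => 0, fun j => ?_, fun j => ?_, fun j hj => ?_, fun n => ?_⟩
  · match j with
    | 0 => simpa only [norm_coeComplex] using hu₁
    | 1 => simpa only [norm_coeComplex] using hu₂
    | j + 2 => simp
  · match j with
    | 0 => simpa only [norm_coeComplex] using hv₁
    | 1 => simpa only [norm_mul, norm_unitJ, mul_one, norm_coeComplex] using hv₂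
    | j + 2 => simp
  · match j with
    | 0 => simp at hj
    | 1 => simp at hj
    | j + 2 => rfl
  · simp only [Finset.sum_range_succ _ 1, Finset.sum_range_one]
    rw [← coe_fst_add_coe_snd_mul (f n), h₁, h₂, ← coe_ofComplex, map_sum, map_sum, Finset.sum_mul]
    simp only [map_mul, mul_assoc]

end

/-- **`H¹(𝔹)` coincides with the weak ⋆-product `H²(𝔹) ⊛ H²(𝔹)`.**
A regular function `f(q) = ∑ₙ qⁿ f̌(n)` on `𝔹` belongs to `H¹(𝔹)` if and only if there
exist sequences `f_j, g_j ∈ H²(𝔹)` (given by coefficient sequences `F j`, `G j`) with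
`∑_j ‖f_j‖_{H²}·‖g_j‖_{H²} < ∞` and `f = ∑_j f_j ⋆ g_j`, the sum over `j` converging
absolutely coefficientwise. -/
theorem memH1_iff_weak_star_product (f : ℕ → ℍ[ℝ])
    (hconv : ∀ r : ℝ, 0 ≤ r → r < 1 → Summable fun n => r ^ n * ‖f n‖) :
    MemH1 f ↔
    ∃ F G : ℕ → ℕ → ℍ[ℝ],
      (∀ j : ℕ, Summable (fun n => ‖F j n‖ ^ 2)) ∧
      (∀ j : ℕ, Summable (fun n => ‖G j n‖ ^ 2)) ∧
      Summable (fun j : ℕ =>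
        (∑' n : ℕ, ‖F j n‖ ^ 2) ^ (1 / 2 : ℝ) * (∑' n : ℕ, ‖G j n‖ ^ 2) ^ (1 / 2 : ℝ)) ∧
      ∀ n : ℕ,
        Summable (fun j : ℕ => ‖∑ k ∈ Finset.range (n + 1), F j k * G j (n - k)‖) ∧
        f n = ∑' j : ℕ, ∑ k ∈ Finset.range (n + 1), F j k * G j (n - k) := by
  constructor
  · intro hf
    obtain ⟨F, G, hF, hG, h0, hfn⟩ := exists_weak_star_product_of_memH1 hconv hf
    refine ⟨F, G, hF, hG, summable_of_ne_finset_zero (s := Finset.range 2) fun j hj => ?_,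
      fun n => ⟨summable_of_ne_finset_zero (s := Finset.range 2) fun j hj => ?_, ?_⟩⟩
    · simp [h0 j hj]
    · simp [h0 j hj]
    · rw [hfn, tsum_eq_sum fun j hj => by simp [h0 j hj]]
  · rintro ⟨F, G, hF, hG, hFG, hf⟩
    exact memH1_of_weak_star_product hF hG hFG fun n => (hf n).2
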